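/- arXiv:2303.06638 — 11 statements merged into one kernel-verified Lean document; each statement's English description precedes it below -/
import Mathlib

section
/- For every Δ > 0, every r ∈ (0, 1/2), every b, f ∈ ℝ and every x ∈ ℝ, the correlation of the box-derivative filter h_Δ with the pulse signal f_{r,b,f} is given exactly by two opposite triangular peaks centered at the edges of the pulse: (h_Δ ⋆ f_{r,b,f})(x) = (f − b) · ( T_Δ(x − (1/2 − r)) − T_Δ(x − (1/2 + r)) ), where T_Δ(s) = max(0, 1 − 2|s|/Δ). -/
open MeasureTheory

/-- The pulse signal `f_{r,b,f}`: value `f` inside the pulse `|x - 1/2| ≤ r`, `b` outside. -/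
noncomputable def pulse (r b f : ℝ) : ℝ → ℝ :=
  fun x => if |x - 1/2| ≤ r then f else b

/-- Correlation of a filter `h` with a signal `g`: `(h ⋆ g)(x) = ∫ h(t) g(x+t) dt`. -/
noncomputable def corr (h g : ℝ → ℝ) (x : ℝ) : ℝ :=
  ∫ t, h t * g (x + t)

/-- The box-derivative filter `h_Δ`. -/
noncomputable def boxDeriv (Δ : ℝ) : ℝ → ℝ :=
  fun t =>
    if 0 < t ∧ t ≤ Δ / 2 then 2 / Δ
    else if -(Δ / 2) ≤ t ∧ t < 0 then -(2 / Δ)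
    else 0

/-- The triangular bump `T_Δ(s) = max(0, 1 - 2|s|/Δ)`. -/
noncomputable def tri (Δ s : ℝ) : ℝ := max 0 (1 - 2 * |s| / Δ)

theorem overlap_aux (u v p q : ℝ) (huv : u ≤ v) (hpq : p ≤ q) :
    max (min v q - max u p) 0 = max u (min v q) - max u (min v p) := by
  simp only [max_def, min_def]
  split_ifs <;> linarith

theorem clamp_aux (d t : ℝ) (hd : 0 < d) :
    max 0 (min d t) - max (-d) (min 0 t) = d - max 0 (d - |t|) := by
  rcases abs_cases t with ⟨h1, h1'⟩ | ⟨h1, h1'⟩ <;>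
    rw [h1] <;> simp only [max_def, min_def] <;> split_ifs <;> linarith

theorem tri_aux (d p q : ℝ) (hd : 0 < d) (hpq : p < q) :
    max (min d q - max 0 p) 0 - max (min 0 q - max (-d) p) 0
      = max 0 (d - |p|) - max 0 (d - |q|) := by
  rw [overlap_aux _ _ _ _ hd.le hpq.le, overlap_aux _ _ _ _ (by linarith) hpq.le]
  linarith [clamp_aux d p hd, clamp_aux d q hd]

theorem tri_scale (Δ s : ℝ) (hΔ : 0 < Δ) : tri Δ s = 2 / Δ * max 0 (Δ / 2 - |s|) := by
  rw [tri, mul_max_of_nonneg _ _ (by positivity)]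
  congr 1
  · simp
  · field_simp

theorem int_ind (a b c : ℝ) :
    Integrable ((Set.Ioc a b).indicator (fun _ => c)) ∧
      ∫ t, (Set.Ioc a b).indicator (fun _ => c) t = max (b - a) 0 * c := by
  constructor
  · rw [integrable_indicator_iff measurableSet_Ioc]
    exact integrableOn_const (by simp)
  · rw [integral_indicator_const _ measurableSet_Ioc, Real.volume_real_Ioc, smul_eq_mul]

theorem stmt_0 (Δ : ℝ) (hΔ : 0 < Δ) (r : ℝ) (hr : r ∈ Set.Ioo (0 : ℝ) (1 / 2))
    (b f x : ℝ) :
    corr (boxDeriv Δ) (pulse r b f) x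
      = (f - b) * (tri Δ (x - (1 / 2 - r)) - tri Δ (x - (1 / 2 + r))) := by
  have ae : (fun t => boxDeriv Δ t * pulse r b f (x + t)) =ᵐ[volume]
      (fun t => ((Set.Ioc 0 (Δ/2)).indicator (fun _ => 2 / Δ * b) t
        + (Set.Ioc (-(Δ/2)) 0).indicator (fun _ => -(2 / Δ * b)) t)
        + ((Set.Ioc (max 0 (1/2 - r - x)) (min (Δ/2) (1/2 + r - x))).indicator
            (fun _ => 2 / Δ * (f - b)) t
        + (Set.Ioc (max (-(Δ/2)) (1/2 - r - x)) (min 0 (1/2 + r - x))).indicator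
            (fun _ => -(2 / Δ * (f - b))) t)) := by
    filter_upwards [Measure.ae_ne volume (0 : ℝ), Measure.ae_ne volume (-(Δ/2)),
      Measure.ae_ne volume (1/2 - r - x)] with t h0 h1 h2
    have e1 : |x + t - 1/2| ≤ r ↔ (1/2 - r - x < t ∧ t ≤ 1/2 + r - x) := by
      rw [abs_le]
      constructor
      · rintro ⟨h, h'⟩
        exact ⟨lt_of_le_of_ne (by linarith) (Ne.symm h2), by linarith⟩
      · rintro ⟨h, h'⟩
        constructor <;> linarith
    have e2 : (-(Δ/2) ≤ t ∧ t < 0) ↔ (-(Δ/2) < t ∧ t ≤ 0) :=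
      ⟨fun h => ⟨lt_of_le_of_ne h.1 (Ne.symm h1), h.2.le⟩,
        fun h => ⟨h.1.le, lt_of_le_of_ne h.2 h0⟩⟩
    simp only [boxDeriv, pulse, e1, e2, Set.indicator_apply, Set.mem_Ioc, max_lt_iff, le_min_iff]
    by_cases a1 : 0 < t
    · have : ¬ t ≤ 0 := not_le.2 a1
      by_cases a2 : t ≤ Δ/2 <;> by_cases a3 : 1/2 - r - x < t <;>
        by_cases a4 : t ≤ 1/2 + r - x <;> simp only [*] <;> simp <;> ring
    · have : t ≤ 0 := not_lt.1 a1
      by_cases a2 : -(Δ/2) < t <;> by_cases a3 : 1/2 - r - x < t <;>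
        by_cases a4 : t ≤ 1/2 + r - x <;> simp only [*] <;> simp <;> ring
  have key := tri_aux (Δ/2) (1/2 - r - x) (1/2 + r - x) (by linarith) (by linarith [hr.1])
  have i := fun a b c => (int_ind a b c).1
  rw [corr, integral_congr_ae ae, integral_add (by exact (i _ _ _).add (i _ _ _))
      (by exact (i _ _ _).add (i _ _ _)),
    integral_add (i _ _ _) (i _ _ _), integral_add (i _ _ _) (i _ _ _),
    (int_ind _ _ _).2, (int_ind _ _ _).2, (int_ind _ _ _).2, (int_ind _ _ _).2,
    tri_scale _ _ hΔ, tri_scale _ _ hΔ, abs_sub_comm x, abs_sub_comm x]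
  have z : (0 : ℝ) - -(Δ/2) = Δ/2 - 0 := by ring
  rw [z]
  linear_combination (2 / Δ * (f - b)) * key
end

section
/- Let h : ℝ → ℝ be an integrable positive derivative filter, i.e. h(t) ≥ 0 for t > 0, h(t) ≤ 0 for t < 0, and ∫_ℝ h = 0. Then for every bounded, monotonically nondecreasing measurable function g : ℝ → ℝ and every x ∈ ℝ, the correlation is nonnegative: (h ⋆ g)(x) ≥ 0. -/
open MeasureTheory

theorem stmt_3 (h : ℝ → ℝ) (hInt : Integrable h)
    (hpos : ∀ t : ℝ, 0 < t → 0 ≤ h t) (hneg : ∀ t : ℝ, t < 0 → h t ≤ 0)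
    (hunbiased : (∫ t, h t) = 0)
    (g : ℝ → ℝ) (hg_meas : Measurable g) (hg_bdd : ∃ M : ℝ, ∀ x, |g x| ≤ M)
    (hg_mono : Monotone g) (x : ℝ) :
    0 ≤ corr h g x := by
  obtain ⟨M, hM⟩ := hg_bdd
  have hi : Integrable (fun t => h t * g (x + t)) := by
    refine hInt.mul_bdd (c := M) ?_ ?_
    · exact (hg_meas.comp (measurable_const_add x)).aestronglyMeasurable
    · exact Filter.Eventually.of_forall fun t => by simpa using hM (x + t)
  have h0 : (∫ t, h t * g x) = 0 := by
    rw [integral_mul_const, hunbiased, zero_mul]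
  unfold corr
  rw [← h0]
  refine integral_mono (hInt.mul_const _) hi fun t => ?_
  rcases lt_trichotomy t 0 with ht | ht | ht
  · exact mul_le_mul_of_nonpos_left (hg_mono (by linarith)) (hneg t ht)
  · simp [ht]
  · exact mul_le_mul_of_nonneg_left (hg_mono (by linarith)) (hpos t ht)
end

section
/- Let a : [0,1] → ℝ be integrable. If for some r ∈ (Δ, 1/2 − Δ) the readout c ↦ ∫_0^1 a(x) v^+_{r,c}(x) dx takes the same value for two distinct peak heights c ≠ c' (both > b_h), then the weight map integrates to zero over the left peak interval: ∫_{P_l(r)} a(x) dx = 0. Consequently, if for every r ∈ (Δ, 1/2 − Δ) the readout is independent of the peak height c on a nondegenerate interval of values of c, then ∫_{P_l(r)} a(x) dx = 0 for every r ∈ (Δ, 1/2 − Δ). -/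
open MeasureTheory

/-- Left peak interval `P_l(r) = [1/2 - r - Δ, 1/2 - r + Δ]`. -/
def Pleft (Δ r : ℝ) : Set ℝ := Set.Icc (1 / 2 - r - Δ) (1 / 2 - r + Δ)

/-- Right peak interval `P_r(r) = [1/2 + r - Δ, 1/2 + r + Δ]`. -/
def Pright (Δ r : ℝ) : Set ℝ := Set.Icc (1 / 2 + r - Δ) (1 / 2 + r + Δ)

open Classical in
/-- Idealized positive-polarity activated representation: `b_h + c` on `P_l(r)`,
`0` on `P_r(r)`, and `b_h` elsewhere. -/
noncomputable def vplus (Δ bh r c : ℝ) : ℝ → ℝ :=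
  fun x => if x ∈ Pleft Δ r then bh + c else if x ∈ Pright Δ r then 0 else bh

open Classical in
/-- Idealized negative-polarity activated representation: `b_h + c` on `P_r(r)`,
`0` on `P_l(r)`, and `b_h` elsewhere. -/
noncomputable def vminus (Δ bh r c : ℝ) : ℝ → ℝ :=
  fun x => if x ∈ Pright Δ r then bh + c else if x ∈ Pleft Δ r then 0 else bh

lemma readout_eq (Δ bh r c : ℝ) (hr : r ∈ Set.Ioo Δ (1 / 2 - Δ)) (hΔ : 0 < Δ)
    (a : ℝ → ℝ) (ha : IntegrableOn a (Set.Icc (0 : ℝ) 1)) :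
    (∫ x in Set.Icc (0 : ℝ) 1, a x * vplus Δ bh r c x)
      = (∫ x in Set.Icc (0 : ℝ) 1, (bh * a x - bh * (Pright Δ r \ Pleft Δ r).indicator a x))
        + c * ∫ x in Pleft Δ r, a x := by
  have hl : MeasurableSet (Pleft Δ r) := measurableSet_Icc
  have hrr : MeasurableSet (Pright Δ r) := measurableSet_Icc
  have hsub : Pleft Δ r ⊆ Set.Icc 0 1 := by
    intro x hx
    obtain ⟨h1, h2⟩ := hx
    obtain ⟨h3, h4⟩ := hr
    constructor <;> linarith
  have hind : (∫ x in Set.Icc (0 : ℝ) 1, (Pleft Δ r).indicator a x) = ∫ x in Pleft Δ r, a x := by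
    rw [setIntegral_indicator hl, Set.inter_eq_right.mpr hsub]
  have ha' : Integrable a (volume.restrict (Set.Icc (0 : ℝ) 1)) := ha
  rw [← hind, ← integral_const_mul, ← integral_add]
  · congr 1
    funext x
    by_cases h1 : x ∈ Pleft Δ r
    · simp [vplus, h1]; ring
    · by_cases h2 : x ∈ Pright Δ r
      · simp [vplus, h1, h2]
      · simp [vplus, h1, h2]; ring
  · exact (ha'.const_mul bh).sub ((ha'.indicator (hrr.diff hl)).const_mul bh)
  · exact (ha'.indicator hl).const_mul c

theorem stmt_5 (Δ bh : ℝ) (hΔ : Δ ∈ Set.Ioo (0 : ℝ) (1 / 4)) (hbh : 0 < bh)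
    (a : ℝ → ℝ) (ha : IntegrableOn a (Set.Icc (0 : ℝ) 1)) :
    (∀ r ∈ Set.Ioo Δ (1 / 2 - Δ), ∀ c c' : ℝ, bh < c → bh < c' → c ≠ c' →
      (∫ x in Set.Icc (0 : ℝ) 1, a x * vplus Δ bh r c x)
        = (∫ x in Set.Icc (0 : ℝ) 1, a x * vplus Δ bh r c' x) →
      (∫ x in Pleft Δ r, a x) = 0) ∧
    ((∀ r ∈ Set.Ioo Δ (1 / 2 - Δ), ∃ c₀ c₁ : ℝ, bh ≤ c₀ ∧ c₀ < c₁ ∧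
        ∀ c ∈ Set.Ioo c₀ c₁, ∀ c' ∈ Set.Ioo c₀ c₁,
          (∫ x in Set.Icc (0 : ℝ) 1, a x * vplus Δ bh r c x)
            = (∫ x in Set.Icc (0 : ℝ) 1, a x * vplus Δ bh r c' x)) →
      ∀ r ∈ Set.Ioo Δ (1 / 2 - Δ), (∫ x in Pleft Δ r, a x) = 0) := by
  have key : ∀ r ∈ Set.Ioo Δ (1 / 2 - Δ), ∀ c c' : ℝ, c ≠ c' →
      (∫ x in Set.Icc (0 : ℝ) 1, a x * vplus Δ bh r c x)
        = (∫ x in Set.Icc (0 : ℝ) 1, a x * vplus Δ bh r c' x) →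
      (∫ x in Pleft Δ r, a x) = 0 := by
    intro r hr c c' hne h
    rw [readout_eq Δ bh r c hr hΔ.1 a ha, readout_eq Δ bh r c' hr hΔ.1 a ha] at h
    by_contra h0
    exact hne (mul_right_cancel₀ h0 (add_left_cancel h))
  refine ⟨fun r hr c c' _ _ hne h => key r hr c c' hne h, fun H r hr => ?_⟩
  obtain ⟨c₀, c₁, _, hlt, h⟩ := H r hr
  refine key r hr ((2 * c₀ + c₁) / 3) ((c₀ + 2 * c₁) / 3) ?_ (h _ ?_ _ ?_)
  · intro he
    linarith
  · constructor <;> linarith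
  · constructor <;> linarith
end

section
/- Let a : [0,1] → ℝ be integrable, let b_a ∈ ℝ, and let c_1 > b_h. Suppose the network is exactly correct on all idealized positive-polarity representations: ∫_0^1 a(x) v^+_{r,c}(x) dx + b_a = r for every r ∈ (Δ, 1/2 − Δ) and every c ∈ (b_h, c_1). Then for every r ∈ (Δ, 1/2 − Δ): (i) ∫_{P_l(r)} a(x) dx = 0, and (ii) ∫_{P_r(r)} a(x) dx = ∫_0^1 a(x) dx + (b_a − r)/b_h; in particular the map r ↦ ∫_{P_r(r)} a(x) dx is affine in r with slope −1/b_h. -/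
open MeasureTheory

theorem stmt_6 (Δ bh : ℝ) (hΔ : Δ ∈ Set.Ioo (0 : ℝ) (1 / 4)) (hbh : 0 < bh)
    (a : ℝ → ℝ) (ha : IntegrableOn a (Set.Icc (0 : ℝ) 1)) (ba : ℝ)
    (c₁ : ℝ) (hc₁ : bh < c₁)
    (hcorrect : ∀ r ∈ Set.Ioo Δ (1 / 2 - Δ), ∀ c ∈ Set.Ioo bh c₁,
      (∫ x in Set.Icc (0 : ℝ) 1, a x * vplus Δ bh r c x) + ba = r) :
    ∀ r ∈ Set.Ioo Δ (1 / 2 - Δ),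
      (∫ x in Pleft Δ r, a x) = 0 ∧
      (∫ x in Pright Δ r, a x)
        = (∫ x in Set.Icc (0 : ℝ) 1, a x) + (ba - r) / bh := by
  intro r hr
  obtain ⟨hr1, hr2⟩ := hr
  obtain ⟨hΔ0, hΔ1⟩ := hΔ
  have hL : Pleft Δ r ⊆ Set.Icc (0 : ℝ) 1 := by
    intro x hx
    simp only [Pleft, Set.mem_Icc] at hx ⊢
    constructor <;> linarith [hx.1, hx.2]
  have hR : Pright Δ r ⊆ Set.Icc (0 : ℝ) 1 := by
    intro x hx
    simp only [Pright, Set.mem_Icc] at hx ⊢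
    constructor <;> linarith [hx.1, hx.2]
  have hmL : MeasurableSet (Pleft Δ r) := measurableSet_Icc
  have hmR : MeasurableSet (Pright Δ r) := measurableSet_Icc
  have hd : ∀ x, x ∈ Pleft Δ r → x ∉ Pright Δ r := by
    intro x hx hx'
    simp only [Pleft, Pright, Set.mem_Icc] at hx hx'
    linarith [hx.2, hx'.1]
  have key : ∀ c, (∫ x in Set.Icc (0 : ℝ) 1, a x * vplus Δ bh r c x)
      = bh * (∫ x in Set.Icc (0 : ℝ) 1, a x) + c * (∫ x in Pleft Δ r, a x)
        - bh * (∫ x in Pright Δ r, a x) := by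
    intro c
    have e : ∀ x, a x * vplus Δ bh r c x = bh * a x + c * (Pleft Δ r).indicator a x
        - bh * (Pright Δ r).indicator a x := by
      intro x
      by_cases h1 : x ∈ Pleft Δ r
      · have h2 := hd x h1
        simp [vplus, h1, h2]
        ring
      · by_cases h2 : x ∈ Pright Δ r
        · simp [vplus, h1, h2]
        · simp [vplus, h1, h2]
          ring
    have iL : IntegrableOn ((Pleft Δ r).indicator a) (Set.Icc (0 : ℝ) 1) :=
      Integrable.indicator ha hmL
    have iR : IntegrableOn ((Pright Δ r).indicator a) (Set.Icc (0 : ℝ) 1) :=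
      Integrable.indicator ha hmR
    have iS : Integrable (fun x => bh * a x + c * (Pleft Δ r).indicator a x)
        (volume.restrict (Set.Icc (0 : ℝ) 1)) := (ha.const_mul bh).add (iL.const_mul c)
    simp_rw [e]
    rw [integral_sub iS (iR.const_mul bh),
      integral_add (ha.const_mul bh) (iL.const_mul c), integral_const_mul, integral_const_mul,
      integral_const_mul, setIntegral_indicator hmL, setIntegral_indicator hmR,
      Set.inter_eq_self_of_subset_right hL, Set.inter_eq_self_of_subset_right hR]
  have h1 := hcorrect r ⟨hr1, hr2⟩ ((2 * bh + c₁) / 3) ⟨by linarith, by linarith⟩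
  have h2 := hcorrect r ⟨hr1, hr2⟩ ((bh + 2 * c₁) / 3) ⟨by linarith, by linarith⟩
  rw [key] at h1 h2
  have hz : (∫ x in Pleft Δ r, a x) = 0 := by
    have h3 : (c₁ - bh) * (∫ x in Pleft Δ r, a x) = 0 := by linarith
    rcases mul_eq_zero.mp h3 with h | h
    · linarith
    · exact h
  refine ⟨hz, ?_⟩
  rw [hz] at h1
  field_simp
  linarith
end

section
/- Define the weight map a : [0,1] → ℝ by a(x) = 0 for x ∈ [0, 1/2) and a(x) = (1/4 − (x − 1/2)) / (2 Δ b_h) for x ∈ [1/2, 1], and set the final bias b_a = 1/4. Then the designed network recovers the radius exactly on all idealized positive-polarity representations: for every r ∈ (Δ, 1/2 − Δ) and every c > b_h, ∫_0^1 a(x) v^+_{r,c}(x) dx + b_a = r. -/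
open MeasureTheory

theorem stmt_7 (Δ bh : ℝ) (hΔ : Δ ∈ Set.Ioo (0 : ℝ) (1 / 4)) (hbh : 0 < bh)
    (r : ℝ) (hr : r ∈ Set.Ioo Δ (1 / 2 - Δ)) (c : ℝ) (hc : bh < c) :
    (∫ x in Set.Icc (0 : ℝ) 1,
        (if x < 1 / 2 then 0 else (1 / 4 - (x - 1 / 2)) / (2 * Δ * bh))
          * vplus Δ bh r c x) + 1 / 4 = r := by
  obtain ⟨h1, h2⟩ := hΔ
  obtain ⟨h3, h4⟩ := hr
  have key : ∀ x : ℝ, (Set.Icc (0:ℝ) 1).indicator (fun x =>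
      (if x < 1 / 2 then 0 else (1 / 4 - (x - 1 / 2)) / (2 * Δ * bh))
          * vplus Δ bh r c x) x =
      (Set.Icc (1/2:ℝ) 1).indicator (fun x => (3/4 - x) / (2 * Δ)) x -
      (Set.Icc (1 / 2 + r - Δ) (1 / 2 + r + Δ)).indicator (fun x => (3/4 - x) / (2 * Δ)) x := by
    intro x
    have e : (1 / 4 - (x - 1 / 2)) / (2 * Δ * bh) * bh = (3/4 - x) / (2 * Δ) := by
      field_simp
      ring
    simp only [Set.indicator_apply, vplus, Pleft, Pright, Set.mem_Icc]
    split_ifs <;> first | (exfalso; grind) | (rw [e]; ring) | ring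
  have hi : ∀ a b : ℝ, IntegrableOn (fun x : ℝ => (3/4 - x) / (2 * Δ)) (Set.Icc a b) := by
    intro a b
    exact Continuous.integrableOn_Icc (by fun_prop)
  have hv : ∀ a b : ℝ, a ≤ b → ∫ x in Set.Icc a b, (3/4 - x) / (2 * Δ) =
      (3/4 * (b - a) - (b^2 - a^2)/2) / (2 * Δ) := by
    intro a b hab
    rw [integral_Icc_eq_integral_Ioc, ← intervalIntegral.integral_of_le hab,
      intervalIntegral.integral_div, intervalIntegral.integral_sub (by simp) (by simp)]
    simp
    ring
  rw [← integral_indicator measurableSet_Icc, integral_congr_ae (Filter.Eventually.of_forall key),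
    integral_sub ((hi _ _).integrable_indicator measurableSet_Icc)
      ((hi _ _).integrable_indicator measurableSet_Icc),
    integral_indicator measurableSet_Icc, integral_indicator measurableSet_Icc,
    hv _ _ (by norm_num), hv _ _ (by linarith)]
  field_simp
  ring
end

section
/- Define the weight map a : [0,1] → ℝ by a(x) = 0 for x ∈ [0, 1/2) and a(x) = (1/4 − (x − 1/2)) / (2 Δ b_h) for x ∈ [1/2, 1], and set b_a = 1/4. Then on every idealized negative-polarity representation the output is ∫_0^1 a(x) v^−_{r,c}(x) dx + b_a = 1/4 + c (1/4 − r)/b_h for all r ∈ (Δ, 1/2 − Δ) and c > b_h. In particular, for every r ≠ 1/4 the output depends nontrivially on the peak height c (hence on the signal intensities) and differs from r, so the network that is correct on positive polarity fails on negative polarity. -/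
open MeasureTheory

open Classical in
/-- The designed weight map: `0` on `[0, 1/2)` and affine on `[1/2, 1]`. -/
noncomputable def aDesigned (Δ bh : ℝ) : ℝ → ℝ :=
  fun x => if x < 1 / 2 then 0 else (1 / 4 - (x - 1 / 2)) / (2 * Δ * bh)

lemma aff_int (a b k : ℝ) (h : a ≤ b) :
    ∫ x in Set.Icc a b, (3 / 4 - x) * k = k * (3 / 4 * (b - a) - (b ^ 2 - a ^ 2) / 2) := by
  rw [integral_Icc_eq_integral_Ioc, ← intervalIntegral.integral_of_le h,
    intervalIntegral.integral_mul_const, intervalIntegral.integral_sub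
      (by simp) (by simp)]
  simp
  ring

lemma main_int (Δ bh : ℝ) (hΔ : Δ ∈ Set.Ioo (0 : ℝ) (1 / 4)) (hbh : 0 < bh)
    (r : ℝ) (hr : r ∈ Set.Ioo Δ (1 / 2 - Δ)) (c : ℝ) :
    (∫ x in Set.Icc (0 : ℝ) 1, aDesigned Δ bh x * vminus Δ bh r c x)
      = c * (1 / 4 - r) / bh := by
  obtain ⟨h1, h2⟩ := hΔ
  obtain ⟨h3, h4⟩ := hr
  have e : ∀ x, x ∈ Set.Icc (0 : ℝ) 1 → aDesigned Δ bh x * vminus Δ bh r c x =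
      (Set.Icc (1 / 2 : ℝ) 1).indicator (fun x => (3 / 4 - x) * (1 / (2 * Δ))) x +
      (Pright Δ r).indicator (fun x => (3 / 4 - x) * (c / (2 * Δ * bh))) x := by
    intro x hx
    obtain ⟨hx0, hx1⟩ := hx
    unfold aDesigned vminus
    by_cases hx2 : x < 1 / 2
    · have n1 : x ∉ Set.Icc (1 / 2 : ℝ) 1 := fun h => absurd h.1 (not_le.2 hx2)
      have n2 : x ∉ Pright Δ r := fun h => by have := h.1; linarith
      simp only [if_pos hx2, Set.indicator_of_notMem n1, Set.indicator_of_notMem n2]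
      ring
    · have n1 : x ∈ Set.Icc (1 / 2 : ℝ) 1 := ⟨not_lt.1 hx2, hx1⟩
      have n3 : x ∉ Pleft Δ r := fun h => by have := h.2; linarith
      by_cases n2 : x ∈ Pright Δ r
      · simp only [if_neg hx2, if_pos n2, Set.indicator_of_mem n1, Set.indicator_of_mem n2]
        field_simp
        ring
      · simp only [if_neg hx2, if_neg n2, if_neg n3, Set.indicator_of_mem n1,
          Set.indicator_of_notMem n2]
        field_simp
        ring
  have hi : ∀ k a b : ℝ, IntegrableOn
      ((Set.Icc a b).indicator (fun x : ℝ => (3 / 4 - x) * k)) (Set.Icc 0 1) := by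
    intro k a b
    apply Integrable.indicator _ measurableSet_Icc
    exact (by fun_prop : Continuous (fun x : ℝ => (3 / 4 - x) * k)).continuousOn.integrableOn_Icc
  rw [setIntegral_congr_fun measurableSet_Icc e]
  unfold Pright
  rw [integral_add (hi _ _ _) (hi _ _ _), setIntegral_indicator measurableSet_Icc,
    setIntegral_indicator measurableSet_Icc,
    Set.inter_eq_right.2 (Set.Icc_subset_Icc (by norm_num) le_rfl),
    Set.inter_eq_right.2 (Set.Icc_subset_Icc (by linarith) (by linarith)),
    aff_int _ _ _ (by norm_num), aff_int _ _ _ (by linarith)]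
  field_simp
  ring

theorem stmt_8 (Δ bh : ℝ) (hΔ : Δ ∈ Set.Ioo (0 : ℝ) (1 / 4)) (hbh : 0 < bh) :
    ∀ r ∈ Set.Ioo Δ (1 / 2 - Δ), ∀ c : ℝ, bh < c →
      ((∫ x in Set.Icc (0 : ℝ) 1, aDesigned Δ bh x * vminus Δ bh r c x) + 1 / 4
          = 1 / 4 + c * (1 / 4 - r) / bh) ∧
      (r ≠ 1 / 4 →
        (∫ x in Set.Icc (0 : ℝ) 1, aDesigned Δ bh x * vminus Δ bh r c x) + 1 / 4 ≠ r) ∧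
      (r ≠ 1 / 4 → ∀ c' : ℝ, bh < c' → c ≠ c' →
        (∫ x in Set.Icc (0 : ℝ) 1, aDesigned Δ bh x * vminus Δ bh r c x) + 1 / 4
          ≠ (∫ x in Set.Icc (0 : ℝ) 1, aDesigned Δ bh x * vminus Δ bh r c' x) + 1 / 4) := by
  intro r hr c hc
  rw [main_int Δ bh hΔ hbh r hr c]
  refine ⟨by ring, ?_, ?_⟩
  · intro h e
    field_simp at e
    have : (1 - 4 * r) * (bh + c) = 0 := by linarith
    rcases mul_eq_zero.1 this with h' | h'
    · exact h (by linarith)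
    · linarith
  · intro h c' _ hcc e
    rw [main_int Δ bh hΔ hbh r hr c'] at e
    have e2 : c * (1 / 4 - r) / bh = c' * (1 / 4 - r) / bh := by linarith
    rw [div_left_inj' hbh.ne'] at e2
    exact hcc (mul_right_cancel₀ (sub_ne_zero.2 (Ne.symm h)) e2)
end

section
/- Fix Δ ∈ (0, 1/4), b_h > 0 and c_1 > b_h. There exist no integrable weight map a : [0,1] → ℝ and bias b_a ∈ ℝ such that the affine readout is simultaneously correct on both polarities, i.e. such that ∫_0^1 a(x) v^+_{r,c}(x) dx + b_a = r and ∫_0^1 a(x) v^−_{r,c}(x) dx + b_a = r hold for every r ∈ (Δ, 1/2 − Δ) and every c ∈ (b_h, c_1). In other words, a single-channel, single-layer ReLU network built on a derivative filter cannot correctly estimate the radius when both polarities are present. -/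
open MeasureTheory

open Classical in
lemma readout_aux (a : ℝ → ℝ) (ha : IntegrableOn a (Set.Icc (0 : ℝ) 1)) (S T : Set ℝ)
    (hS : MeasurableSet S) (hT : MeasurableSet T) (hd : ∀ x, x ∈ S → x ∉ T) (bh c : ℝ) :
    (∫ x in Set.Icc (0 : ℝ) 1, a x * (if x ∈ S then bh + c else if x ∈ T then 0 else bh)) =
      bh * (∫ x in Set.Icc (0 : ℝ) 1, a x) + c * (∫ x in Set.Icc (0 : ℝ) 1, S.indicator a x)
        - bh * (∫ x in Set.Icc (0 : ℝ) 1, T.indicator a x) := by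
  have h1 : Integrable (fun x => bh * a x) (volume.restrict (Set.Icc (0 : ℝ) 1)) :=
    ha.const_mul bh
  have h2 : Integrable (fun x => c * S.indicator a x) (volume.restrict (Set.Icc (0 : ℝ) 1)) :=
    (Integrable.indicator ha hS).const_mul c
  have h3 : Integrable (fun x => bh * T.indicator a x) (volume.restrict (Set.Icc (0 : ℝ) 1)) :=
    (Integrable.indicator ha hT).const_mul bh
  have h12 : Integrable (fun x => bh * a x + c * S.indicator a x)
      (volume.restrict (Set.Icc (0 : ℝ) 1)) := h1.add h2
  rw [← integral_const_mul, ← integral_const_mul, ← integral_const_mul,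
    ← integral_add h1 h2, ← integral_sub h12 h3]
  congr 1
  funext x
  by_cases hx : x ∈ S
  · have := hd x hx
    simp [hx, this]; ring
  · by_cases hy : x ∈ T <;> simp [hx, hy]; ring

theorem stmt_9 (Δ bh c₁ : ℝ) (hΔ : Δ ∈ Set.Ioo (0 : ℝ) (1 / 4)) (hbh : 0 < bh)
    (hc₁ : bh < c₁) :
    ¬ ∃ (a : ℝ → ℝ) (ba : ℝ), IntegrableOn a (Set.Icc (0 : ℝ) 1) ∧
      ∀ r ∈ Set.Ioo Δ (1 / 2 - Δ), ∀ c ∈ Set.Ioo bh c₁,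
        (∫ x in Set.Icc (0 : ℝ) 1, a x * vplus Δ bh r c x) + ba = r ∧
        (∫ x in Set.Icc (0 : ℝ) 1, a x * vminus Δ bh r c x) + ba = r := by
  rintro ⟨a, ba, ha, h⟩
  obtain ⟨h0, h4⟩ := hΔ
  have key : ∀ r ∈ Set.Ioo Δ (1 / 2 - Δ),
      bh * (∫ x in Set.Icc (0 : ℝ) 1, a x) + ba = r := by
    intro r hr
    have hd : ∀ x, x ∈ Pleft Δ r → x ∉ Pright Δ r := by
      intro x hx hy
      have := hx.2
      have := hy.1
      have := hr.1
      linarith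
    have hl : MeasurableSet (Pleft Δ r) := measurableSet_Icc
    have hR : MeasurableSet (Pright Δ r) := measurableSet_Icc
    have E1 := fun c hc => (h r hr c hc).1
    have E2 := fun c hc => (h r hr c hc).2
    simp only [vplus] at E1
    simp only [vminus] at E2
    have F1 := E1 ((2 * bh + c₁) / 3) ⟨by linarith, by linarith⟩
    have F2 := E1 ((bh + 2 * c₁) / 3) ⟨by linarith, by linarith⟩
    have G1 := E2 ((2 * bh + c₁) / 3) ⟨by linarith, by linarith⟩
    have G2 := E2 ((bh + 2 * c₁) / 3) ⟨by linarith, by linarith⟩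
    rw [readout_aux a ha _ _ hl hR hd] at F1 F2
    rw [readout_aux a ha _ _ hR hl (fun x hx hy => hd x hy hx)] at G1 G2
    generalize (∫ x in Set.Icc (0 : ℝ) 1, (Pleft Δ r).indicator a x) = L at *
    generalize (∫ x in Set.Icc (0 : ℝ) 1, (Pright Δ r).indicator a x) = R at *
    have hL : L = 0 := by
      have : (c₁ - bh) * L = 0 := by linarith
      exact (mul_eq_zero.mp this).resolve_left (by linarith)
    have hR0 : R = 0 := by
      have : (c₁ - bh) * R = 0 := by linarith
      exact (mul_eq_zero.mp this).resolve_left (by linarith)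
    subst hL hR0
    linarith
  have k1 := key ((2 * Δ + (1 / 2 - Δ)) / 3) ⟨by linarith, by linarith⟩
  have k2 := key ((Δ + 2 * (1 / 2 - Δ)) / 3) ⟨by linarith, by linarith⟩
  linarith
end

section
/- Fix 0 < r_0 < r_1 < 1/2 and 0 < δ < 1. There exist no integrable filter h : ℝ → ℝ, convolution bias b_h ∈ ℝ, integrable weight map a : [0,1] → ℝ and final bias b_a ∈ ℝ such that simultaneously, for every r ∈ (r_0, r_1) and every b, f ∈ [0, 1] with f ≥ b + δ: (i) the preactivation is everywhere nonnegative on the domain, i.e. (h ⋆ f_{r,b,f})(x) + b_h ≥ 0 for all x ∈ [0,1], and (ii) the network output is exactly the radius, i.e. ∫_0^1 a(x) · max(0, (h ⋆ f_{r,b,f})(x) + b_h) dx + b_a = r. In other words, if the ReLU acts as the identity on all admissible signals (e.g. when the convolution bias is too large), the single-layer network cannot correctly estimate the radius. -/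
open MeasureTheory

theorem corr_pulse_zero (h : ℝ → ℝ) (r f x : ℝ) :
    corr h (pulse r 0 f) x = f * corr h (pulse r 0 1) x := by
  unfold corr
  rw [← integral_const_mul]
  congr 1
  ext t
  unfold pulse
  split_ifs <;> ring

theorem measurable_pulse (r : ℝ) : Measurable (pulse r 0 1) := by
  unfold pulse
  refine Measurable.ite ?_ measurable_const measurable_const
  exact measurableSet_le (by fun_prop) measurable_const

theorem integrable_mul_corr (h a : ℝ → ℝ) (r : ℝ) (hh : Integrable h)
    (ha : IntegrableOn a (Set.Icc (0 : ℝ) 1)) :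
    IntegrableOn (fun x => a x * corr h (pulse r 0 1) x) (Set.Icc (0 : ℝ) 1) := by
  refine Integrable.mul_bdd (c := ∫ t, ‖h t‖) ha ?_ ?_
  · have hm : AEStronglyMeasurable (fun p : ℝ × ℝ => h p.2 * pulse r 0 1 (p.1 + p.2))
        ((volume.restrict (Set.Icc (0 : ℝ) 1)).prod volume) := by
      refine (hh.aestronglyMeasurable.comp_snd).mul ?_
      exact ((measurable_pulse r).comp (measurable_fst.add measurable_snd)).aestronglyMeasurable
    exact hm.integral_prod_right'
  · refine Filter.Eventually.of_forall fun x => ?_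
    unfold corr
    refine norm_integral_le_of_norm_le hh.norm (Filter.Eventually.of_forall fun t => ?_)
    unfold pulse
    split_ifs <;> simp

theorem stmt_10 (r₀ r₁ δ : ℝ) (hr₀ : 0 < r₀) (hr₀₁ : r₀ < r₁) (hr₁ : r₁ < 1 / 2)
    (hδ₀ : 0 < δ) (hδ₁ : δ < 1) :
    ¬ ∃ (h : ℝ → ℝ) (bh : ℝ) (a : ℝ → ℝ) (ba : ℝ),
        Integrable h ∧ IntegrableOn a (Set.Icc (0 : ℝ) 1) ∧
        ∀ r ∈ Set.Ioo r₀ r₁, ∀ b ∈ Set.Icc (0 : ℝ) 1, ∀ f ∈ Set.Icc (0 : ℝ) 1,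
          b + δ ≤ f →
          (∀ x ∈ Set.Icc (0 : ℝ) 1, 0 ≤ corr h (pulse r b f) x + bh) ∧
          (∫ x in Set.Icc (0 : ℝ) 1,
              a x * max 0 (corr h (pulse r b f) x + bh)) + ba = r := by
  rintro ⟨h, bh, a, ba, hh, ha, H⟩
  have key : ∀ r ∈ Set.Ioo r₀ r₁, r = bh * (∫ x in Set.Icc (0 : ℝ) 1, a x) + ba := by
    intro r hr
    have hP := integrable_mul_corr h a r hh ha
    have out : ∀ f ∈ Set.Icc (0 : ℝ) 1, 0 + δ ≤ f →
        f * (∫ x in Set.Icc (0 : ℝ) 1, a x * corr h (pulse r 0 1) x)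
          + bh * (∫ x in Set.Icc (0 : ℝ) 1, a x) + ba = r := by
      intro f hf hfδ
      obtain ⟨h1, h2⟩ := H r hr 0 (by simp) f hf hfδ
      refine Eq.trans ?_ h2
      congr 1
      rw [← integral_const_mul, ← integral_const_mul,
        ← integral_add (hP.const_mul f) (ha.const_mul bh)]
      apply setIntegral_congr_fun measurableSet_Icc
      intro x hx
      have h3 := h1 x hx
      simp only
      rw [max_eq_right h3, corr_pulse_zero h r f x]
      ring
    have e1 := out 1 (by simp) (by linarith)
    have e2 := out δ ⟨hδ₀.le, hδ₁.le⟩ (by linarith)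
    generalize (∫ x in Set.Icc (0 : ℝ) 1, a x * corr h (pulse r 0 1) x) = J at e1 e2
    have hJ : J = 0 := by
      have : (1 - δ) * J = 0 := by linarith
      rcases mul_eq_zero.1 this with h0 | h0
      · linarith
      · exact h0
    rw [hJ] at e1
    linarith
  have k1 := key (r₀ + (r₁ - r₀) / 3) ⟨by linarith, by linarith⟩
  have k2 := key (r₀ + (r₁ - r₀) / 2) ⟨by linarith, by linarith⟩
  linarith
end

section
/- Fix Δ ∈ (0, 1/4), a convolution bias b_h ≤ 0, and 0 < c_0 < c_1 with c_0 > −b_h. For r ∈ (Δ, 1/2 − Δ) and c ∈ (c_0, c_1), let w_{r,c} : [0,1] → ℝ denote the idealized ReLU output for a nonpositive bias: w_{r,c} = (b_h + c) on P_l(r) and w_{r,c} = 0 elsewhere on [0,1] (the plateau max(0, b_h) and the right peak max(0, b_h − c) both vanish). Then there exist no integrable a : [0,1] → ℝ and b_a ∈ ℝ with ∫_0^1 a(x) w_{r,c}(x) dx + b_a = r for all r ∈ (Δ, 1/2 − Δ) and all c ∈ (c_0, c_1): independence of c forces ∫_{P_l(r)} a = 0 for every r, making the output constantly b_a. Hence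 a nonpositive convolution bias cannot yield a correct radius estimator. -/
open MeasureTheory

open Classical in
/-- Idealized ReLU output for a nonpositive convolution bias: `b_h + c` on the
left peak interval `P_l(r)` and `0` elsewhere. -/
noncomputable def wNonposBias (Δ bh r c : ℝ) : ℝ → ℝ :=
  fun x => if x ∈ Pleft Δ r then bh + c else 0

theorem stmt_11 (Δ bh c₀ c₁ : ℝ) (hΔ : Δ ∈ Set.Ioo (0 : ℝ) (1 / 4)) (hbh : bh ≤ 0)
    (hc₀ : 0 < c₀) (hc₀₁ : c₀ < c₁) (hc₀bh : -bh < c₀) :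
    ¬ ∃ (a : ℝ → ℝ) (ba : ℝ), IntegrableOn a (Set.Icc (0 : ℝ) 1) ∧
      ∀ r ∈ Set.Ioo Δ (1 / 2 - Δ), ∀ c ∈ Set.Ioo c₀ c₁,
        (∫ x in Set.Icc (0 : ℝ) 1, a x * wNonposBias Δ bh r c x) + ba = r := by
  obtain ⟨hΔ0, hΔ1⟩ := hΔ
  rintro ⟨a, ba, -, h⟩
  have key : ∀ r ∈ Set.Ioo Δ (1 / 2 - Δ), ba = r := by
    intro r hr
    have hI : ∀ c, (∫ x in Set.Icc (0 : ℝ) 1, a x * wNonposBias Δ bh r c x)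
        = (∫ x in Set.Icc (0 : ℝ) 1, a x * wNonposBias Δ 0 r 1 x) * (bh + c) := by
      intro c
      rw [← integral_mul_const]
      congr 1
      funext x
      unfold wNonposBias
      split_ifs <;> ring
    have h1 := h r hr (c₀ + (c₁ - c₀) / 3) ⟨by linarith, by linarith⟩
    have h2 := h r hr (c₀ + (c₁ - c₀) / 2) ⟨by linarith, by linarith⟩
    rw [hI] at h1 h2
    generalize (∫ x in Set.Icc (0 : ℝ) 1, a x * wNonposBias Δ 0 r 1 x) = I at h1 h2
    have h3 : I * (c₁ - c₀) = 0 := by linarith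
    have h4 : I = 0 := by
      rcases mul_eq_zero.mp h3 with h5 | h5
      · exact h5
      · linarith
    rw [h4] at h1
    linarith
  have k1 := key (1 / 4) ⟨by linarith, by linarith⟩
  have k2 := key ((Δ + 1 / 4) / 2) ⟨by linarith, by linarith⟩
  linarith
end

section
/- Let σ_τ be the piecewise-linear sigmoid with threshold τ > 0. Suppose b_h ≤ −τ and c ≥ τ − b_h. Then for every r ∈ (Δ, 1/2 − Δ): (i) σ_τ ∘ g^+_{r,c} is the indicator function of P_l(r) on [0,1] and σ_τ ∘ g^−_{r,c} is the indicator function of P_r(r) on [0,1]; and (ii) with the symmetric V-shaped weight map a(x) = (|x − 1/2| − 1/4) / (2Δ) and final bias b_a = 1/4, the network output is exactly the radius for both polarities: ∫_0^1 a(x) · σ_τ(g^ε_{r,c}(x)) dx + b_a = r for ε ∈ {+, −}. -/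
open MeasureTheory

open Classical in
/-- Idealized positive-polarity preactivation: `b_h + c` on `P_l(r)`, `b_h - c` on
`P_r(r)`, and `b_h` elsewhere. -/
noncomputable def gplus (Δ bh r c : ℝ) : ℝ → ℝ :=
  fun x => if x ∈ Pleft Δ r then bh + c else if x ∈ Pright Δ r then bh - c else bh

open Classical in
/-- Idealized negative-polarity preactivation: `b_h - c` on `P_l(r)`, `b_h + c` on
`P_r(r)`, and `b_h` elsewhere. -/
noncomputable def gminus (Δ bh r c : ℝ) : ℝ → ℝ :=
  fun x => if x ∈ Pleft Δ r then bh - c else if x ∈ Pright Δ r then bh + c else bh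

/-- Piecewise-linear sigmoid with threshold `τ`: `0` below `-τ`, `1` above `τ`,
linear in between. -/
noncomputable def plSigmoid (τ : ℝ) : ℝ → ℝ :=
  fun x => if x ≤ -τ then 0 else if x < τ then (x + τ) / (2 * τ) else 1

open Classical in
theorem aux_int (Δ m s : ℝ) (hΔ : 0 < Δ) (h0 : 0 ≤ m - Δ) (h1 : m + Δ ≤ 1)
    (hs : ∀ x ∈ Set.Icc (m - Δ) (m + Δ), |x - 1 / 2| = s * (x - 1 / 2)) (F : ℝ → ℝ)
    (S : Set ℝ) (hS : S = Set.Icc (m - Δ) (m + Δ))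
    (hF : ∀ x ∈ Set.Icc (0 : ℝ) 1, F x = if x ∈ S then 1 else 0) :
    (∫ x in Set.Icc (0 : ℝ) 1, ((|x - 1 / 2| - 1 / 4) / (2 * Δ)) * F x)
      = s * (m - 1 / 2) - 1 / 4 := by
  have e1 : (∫ x in Set.Icc (0 : ℝ) 1, ((|x - 1 / 2| - 1 / 4) / (2 * Δ)) * F x)
      = ∫ x in Set.Icc (0 : ℝ) 1, (Set.Icc (m - Δ) (m + Δ)).indicator
        (fun x => (s / (2 * Δ)) * x + (-(s / 2) - 1 / 4) / (2 * Δ)) x := by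
    apply setIntegral_congr_fun measurableSet_Icc
    intro x hx
    simp only [hF x hx, Set.indicator, hS]
    split_ifs with h
    · rw [hs x h]; field_simp; ring
    · simp
  have e2 : Set.Icc (0 : ℝ) 1 ∩ Set.Icc (m - Δ) (m + Δ) = Set.Icc (m - Δ) (m + Δ) :=
    Set.inter_eq_right.mpr (Set.Icc_subset_Icc h0 h1)
  rw [e1, setIntegral_indicator measurableSet_Icc, e2, integral_Icc_eq_integral_Ioc,
    ← intervalIntegral.integral_of_le (by linarith),
    intervalIntegral.integral_add (Continuous.intervalIntegrable (by fun_prop) _ _)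
      (Continuous.intervalIntegrable (by fun_prop) _ _),
    intervalIntegral.integral_const_mul, integral_id, intervalIntegral.integral_const,
    smul_eq_mul]
  field_simp
  ring

open Classical in
theorem stmt_13 (Δ bh τ c : ℝ) (hΔ : Δ ∈ Set.Ioo (0 : ℝ) (1 / 4)) (hτ : 0 < τ)
    (hbh : bh ≤ -τ) (hc : τ - bh ≤ c)
    (r : ℝ) (hr : r ∈ Set.Ioo Δ (1 / 2 - Δ)) :
    (∀ x ∈ Set.Icc (0 : ℝ) 1,
      plSigmoid τ (gplus Δ bh r c x) = if x ∈ Pleft Δ r then 1 else 0) ∧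
    (∀ x ∈ Set.Icc (0 : ℝ) 1,
      plSigmoid τ (gminus Δ bh r c x) = if x ∈ Pright Δ r then 1 else 0) ∧
    (∫ x in Set.Icc (0 : ℝ) 1,
        ((|x - 1 / 2| - 1 / 4) / (2 * Δ)) * plSigmoid τ (gplus Δ bh r c x)) + 1 / 4 = r ∧
    (∫ x in Set.Icc (0 : ℝ) 1,
        ((|x - 1 / 2| - 1 / 4) / (2 * Δ)) * plSigmoid τ (gminus Δ bh r c x)) + 1 / 4 = r := by
  obtain ⟨hΔ0, hΔ1⟩ := hΔ
  obtain ⟨hr0, hr1⟩ := hr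
  have A : ∀ x ∈ Set.Icc (0 : ℝ) 1,
      plSigmoid τ (gplus Δ bh r c x) = if x ∈ Pleft Δ r then 1 else 0 := by
    intro x _
    unfold plSigmoid gplus
    split_ifs <;> first | rfl | (exfalso; linarith)
  have B : ∀ x ∈ Set.Icc (0 : ℝ) 1,
      plSigmoid τ (gminus Δ bh r c x) = if x ∈ Pright Δ r then 1 else 0 := by
    intro x _
    have hd : x ∈ Pleft Δ r → x ∈ Pright Δ r → False := by
      intro h h'
      have h2 := h.2
      have h3 := h'.1
      linarith
    unfold plSigmoid gminus
    split_ifs <;> first | rfl | (exfalso; linarith) | (exfalso; exact hd ‹_› ‹_›)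
  refine ⟨A, B, ?_, ?_⟩
  · rw [aux_int Δ (1 / 2 - r) (-1) hΔ0 (by linarith) (by linarith) ?_ _ _ rfl A]
    · ring
    · rintro x ⟨h, h'⟩
      rw [abs_of_nonpos (by linarith)]; ring
  · rw [aux_int Δ (1 / 2 + r) 1 hΔ0 (by linarith) (by linarith) ?_ _ _ rfl B]
    · ring
    · rintro x ⟨h, h'⟩
      rw [abs_of_nonneg (by linarith)]; ring
end

section
/- Suppose 0 < b_h < c. For polarity ε ∈ {+, −} and r ∈ (Δ, 1/2 − Δ), define the two-layer ReLU output w^ε_{r,c} : [0,1] → ℝ by w^ε_{r,c}(x) = max(0, −max(0, g^ε_{r,c}(x)) + b_h) (the first ReLU output is negated, the bias b_h is added again, and a second ReLU is applied). Then: (i) w^+_{r,c} = b_h · 1_{P_r(r)} and w^−_{r,c} = b_h · 1_{P_l(r)} on [0,1]; and (ii) with the symmetric V-shaped weight map a(x) = (|x − 1/2| − 1/4) / (2Δ b_h) and final bias b_a = 1/4, the network output equals the radius for both polarities: ∫_0^1 a(x) w^ε_{r,c}(x) dx + b_a = r for ε ∈ {+, −} and all r ∈ (Δ, 1/2 − Δ).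 -/
open MeasureTheory

/-- Two-layer ReLU output: the first ReLU output is negated, the bias `b_h` is
added again, and a second ReLU is applied. -/
noncomputable def wPlus (Δ bh r c : ℝ) : ℝ → ℝ :=
  fun x => max 0 (-(max 0 (gplus Δ bh r c x)) + bh)

noncomputable def wMinus (Δ bh r c : ℝ) : ℝ → ℝ :=
  fun x => max 0 (-(max 0 (gminus Δ bh r c x)) + bh)

theorem aux_int_s14 (Δ bh r s m : ℝ) (w : ℝ → ℝ) (hΔ : 0 < Δ) (hbh : 0 < bh)
    (h0 : 0 ≤ m - Δ) (h1 : m + Δ ≤ 1) (hm : s * (m - 1 / 2) = r)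
    (habs : ∀ x ∈ Set.Icc (m - Δ) (m + Δ), |x - 1 / 2| = s * (x - 1 / 2))
    (hin : ∀ x ∈ Set.Icc (m - Δ) (m + Δ), w x = bh)
    (hout : ∀ x ∈ Set.Icc (0 : ℝ) 1, x ∉ Set.Icc (m - Δ) (m + Δ) → w x = 0) :
    (∫ x in Set.Icc (0 : ℝ) 1,
        ((|x - 1 / 2| - 1 / 4) / (2 * Δ * bh)) * w x) + 1 / 4 = r := by
  have hsub : Set.Icc (m - Δ) (m + Δ) ⊆ Set.Icc (0 : ℝ) 1 := Set.Icc_subset_Icc h0 h1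
  rw [setIntegral_eq_of_subset_of_forall_diff_eq_zero measurableSet_Icc hsub
    (fun x hx => by rw [hout x hx.1 hx.2, mul_zero])]
  rw [setIntegral_congr_fun (g := fun x => (s / (2 * Δ)) * x + (- s / 2 - 1 / 4) / (2 * Δ))
    measurableSet_Icc (fun x hx => by
      simp only []
      rw [hin x hx, habs x hx]
      field_simp
      ring)]
  rw [integral_Icc_eq_integral_Ioc, ← intervalIntegral.integral_of_le (by linarith)]
  rw [intervalIntegral.integral_add (by apply Continuous.intervalIntegrable; fun_prop)
    (by apply Continuous.intervalIntegrable; fun_prop), intervalIntegral.integral_const_mul,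
    integral_id, intervalIntegral.integral_const, smul_eq_mul, ← hm]
  field_simp
  ring

open Classical in
theorem stmt_14 (Δ bh c : ℝ) (hΔ : Δ ∈ Set.Ioo (0 : ℝ) (1 / 4))
    (hbh : 0 < bh) (hc : bh < c)
    (r : ℝ) (hr : r ∈ Set.Ioo Δ (1 / 2 - Δ)) :
    (∀ x ∈ Set.Icc (0 : ℝ) 1,
      wPlus Δ bh r c x = if x ∈ Pright Δ r then bh else 0) ∧
    (∀ x ∈ Set.Icc (0 : ℝ) 1,
      wMinus Δ bh r c x = if x ∈ Pleft Δ r then bh else 0) ∧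
    (∫ x in Set.Icc (0 : ℝ) 1,
        ((|x - 1 / 2| - 1 / 4) / (2 * Δ * bh)) * wPlus Δ bh r c x) + 1 / 4 = r ∧
    (∫ x in Set.Icc (0 : ℝ) 1,
        ((|x - 1 / 2| - 1 / 4) / (2 * Δ * bh)) * wMinus Δ bh r c x) + 1 / 4 = r := by
  obtain ⟨hΔ0, hΔ1⟩ := hΔ
  obtain ⟨hr0, hr1⟩ := hr
  have hp : ∀ x, wPlus Δ bh r c x = if x ∈ Pright Δ r then bh else 0 := by
    intro x
    unfold wPlus gplus Pleft Pright
    simp only [Set.mem_Icc]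
    split_ifs <;> grind
  have hm : ∀ x, wMinus Δ bh r c x = if x ∈ Pleft Δ r then bh else 0 := by
    intro x
    unfold wMinus gminus Pleft Pright
    simp only [Set.mem_Icc]
    split_ifs <;> grind
  refine ⟨fun x _ => hp x, fun x _ => hm x, ?_, ?_⟩
  · refine aux_int_s14 Δ bh r 1 (1 / 2 + r) _ hΔ0 hbh (by linarith) (by linarith) (by ring) ?_ ?_ ?_
    · intro x hx
      rw [abs_of_nonneg (by linarith [hx.1]), one_mul]
    · intro x hx
      rw [hp, if_pos (show x ∈ Pright Δ r from hx)]
    · intro x _ hx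
      rw [hp, if_neg (show x ∉ Pright Δ r from hx)]
  · refine aux_int_s14 Δ bh r (-1) (1 / 2 - r) _ hΔ0 hbh (by linarith) (by linarith) (by ring) ?_ ?_ ?_
    · intro x hx
      rw [abs_of_nonpos (by linarith [hx.2]), neg_one_mul]
    · intro x hx
      rw [hm, if_pos (show x ∈ Pleft Δ r from hx)]
    · intro x _ hx
      rw [hm, if_neg (show x ∉ Pleft Δ r from hx)]
end
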